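/- Suppose service rate estimates satisfy |μ̂_i − μ_i| ≤ δ for all i, where δ ≤ Δ with Δ = min{μ̃/2, (Σ_{j∈S} r_j)/|S|, (min_{j∈S} r_j)/(4cλ), Δ_S}. Then the routing probabilities computed from the estimates via the optimal-routing formula satisfy |p̂_i − p_i*| ≤ min{cδ, r_i/(4λ)} for all i, where c = max{c₁, c₂} with c₁ = (1/λ)(1 + 4(Σ_{j∈S} r_j)/μ̃ + |S|) and c₂ = (1/λ) + 30(Σ_{j∈S} r_j)/(λμ̃) + 16|S|/λ. -/

import Mathlib

open Finset

/-- A routing vector is feasible for arrival rate `lam` and service rates `nu`. -/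
def RoutingFeasible (K : ℕ) (lam : ℝ) (nu p : Fin K → ℝ) : Prop :=
  (∀ i, 0 ≤ p i) ∧ (∑ i, p i = 1) ∧ (∀ i, lam * p i < nu i)

/-- Total steady-state mean queue length under routing vector `p`. -/
noncomputable def RoutingObjective (K : ℕ) (lam : ℝ) (nu p : Fin K → ℝ) : ℝ :=
  ∑ i, lam * p i * (1 - nu i) / (nu i - lam * p i)

/-- `p` is an optimal weighted random routing vector for `(lam, nu)`. -/
def IsOptimalRouting (K : ℕ) (lam : ℝ) (nu p : Fin K → ℝ) : Prop :=
  RoutingFeasible K lam nu p ∧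
    ∀ q, RoutingFeasible K lam nu q → RoutingObjective K lam nu p ≤ RoutingObjective K lam nu q

/-- The support of a routing vector. -/
noncomputable def RoutingSupport (K : ℕ) (p : Fin K → ℝ) : Finset (Fin K) :=
  Finset.univ.filter (fun i => 0 < p i)

noncomputable def wtR (x : ℝ) : ℝ := Real.sqrt (x * (1 - x))

theorem wtR_pos {x : ℝ} (h : 0 < x ∧ x < 1) : 0 < wtR x :=
  Real.sqrt_pos.2 (mul_pos h.1 (by linarith [h.2]))

theorem wtR_sq {x : ℝ} (h : 0 < x ∧ x < 1) : wtR x ^ 2 = x * (1 - x) :=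
  Real.sq_sqrt (mul_pos h.1 (by linarith [h.2])).le

/-- Water-filling condition. -/
def WaterFill (K : ℕ) (lam : ℝ) (nu p : Fin K → ℝ) (k : ℝ) : Prop :=
  0 < k ∧ (∑ i, p i = 1) ∧ ∀ i, lam * p i = max 0 (nu i - k * wtR (nu i))

theorem wf_feasible {K : ℕ} {lam : ℝ} {nu p : Fin K → ℝ} {k : ℝ} (hl : 0 < lam)
    (hnu : ∀ i, 0 < nu i ∧ nu i < 1) (h : WaterFill K lam nu p k) :
    RoutingFeasible K lam nu p := by
  obtain ⟨hk, hs, hp⟩ := h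
  refine ⟨fun i => ?_, hs, fun i => ?_⟩
  · have : 0 ≤ lam * p i := by rw [hp]; exact le_max_left _ _
    exact nonneg_of_mul_nonneg_right this hl
  · rw [hp]
    have := mul_pos hk (wtR_pos (hnu i))
    exact max_lt (hnu i).1 (by linarith)

theorem wf_term {n x y k : ℝ} (hn : 0 < n ∧ n < 1) (hk : 0 < k)
    (hx : x = max 0 (n - k * wtR n)) (hy0 : 0 ≤ y) (hy : y < n) :
    x * (1 - n) / (n - x) + n * (1 - n) * (y - x) ^ 2 / ((n - y) * (n - x) ^ 2)
      + (y - x) / k ^ 2 ≤ y * (1 - n) / (n - y) := by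
  have hw := wtR_pos hn
  have hw2 := wtR_sq hn
  have hkw := mul_pos hk hw
  have hxn : x < n := by rw [hx]; exact max_lt hn.1 (by linarith)
  have ha : 0 < n - x := by linarith
  have hb : 0 < n - y := by linarith
  have key : (y - x) / k ^ 2 ≤ n * (1 - n) / (n - x) ^ 2 * (y - x) := by
    rcases le_total (n - k * wtR n) 0 with h | h
    · rw [max_eq_left h] at hx
      subst hx
      rw [← hw2, div_mul_eq_mul_div, div_le_div_iff₀ (by positivity) (by positivity)]
      have : n ^ 2 ≤ (k * wtR n) ^ 2 := by
        apply pow_le_pow_left₀ hn.1.le; linarith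
      nlinarith [mul_le_mul_of_nonneg_left this hy0]
    · rw [max_eq_right h] at hx
      have : n - x = k * wtR n := by linarith
      rw [this, ← hw2]
      apply le_of_eq
      field_simp
  have id : y * (1 - n) / (n - y) - x * (1 - n) / (n - x)
      = n * (1 - n) * (y - x) ^ 2 / ((n - y) * (n - x) ^ 2)
        + n * (1 - n) / (n - x) ^ 2 * (y - x) := by
    field_simp
    ring
  linarith

theorem wf_obj {K : ℕ} {lam : ℝ} {nu p q : Fin K → ℝ} {k : ℝ} (hl : 0 < lam)
    (hnu : ∀ i, 0 < nu i ∧ nu i < 1) (h : WaterFill K lam nu p k)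
    (hq : RoutingFeasible K lam nu q) :
    RoutingObjective K lam nu p + ∑ i, nu i * (1 - nu i) * (lam * q i - lam * p i) ^ 2 /
      ((nu i - lam * q i) * (nu i - lam * p i) ^ 2) ≤ RoutingObjective K lam nu q := by
  have hz : ∑ i, (lam * q i - lam * p i) / k ^ 2 = 0 := by
    rw [← Finset.sum_div, Finset.sum_sub_distrib, ← Finset.mul_sum, ← Finset.mul_sum,
      hq.2.1, h.2.1]
    simp
  unfold RoutingObjective
  have := Finset.sum_le_sum (s := Finset.univ) (fun i _ =>
    wf_term (hnu i) h.1 (h.2.2 i) (mul_nonneg hl.le (hq.1 i)) (hq.2.2 i))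
  rw [Finset.sum_add_distrib, Finset.sum_add_distrib, hz, add_zero] at this
  exact this

theorem wf_optimal {K : ℕ} {lam : ℝ} {nu p : Fin K → ℝ} {k : ℝ} (hl : 0 < lam)
    (hnu : ∀ i, 0 < nu i ∧ nu i < 1) (h : WaterFill K lam nu p k) :
    IsOptimalRouting K lam nu p := by
  refine ⟨wf_feasible hl hnu h, fun q hq => ?_⟩
  have h1 := wf_obj hl hnu h hq
  have : 0 ≤ ∑ i, nu i * (1 - nu i) * (lam * q i - lam * p i) ^ 2 /
      ((nu i - lam * q i) * (nu i - lam * p i) ^ 2) := by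
    apply Finset.sum_nonneg
    intro i _
    have a := hnu i
    have b := hq.2.2 i
    exact div_nonneg (mul_nonneg (mul_nonneg a.1.le (by linarith)) (sq_nonneg _))
      (mul_nonneg (by linarith) (sq_nonneg _))
  linarith

theorem wf_unique {K : ℕ} {lam : ℝ} {nu p q : Fin K → ℝ} {k : ℝ} (hl : 0 < lam)
    (hnu : ∀ i, 0 < nu i ∧ nu i < 1) (h : WaterFill K lam nu p k)
    (hq : IsOptimalRouting K lam nu q) : q = p := by
  have hp := wf_feasible hl hnu h
  have h1 := wf_obj hl hnu h hq.1
  have h2 := hq.2 p hp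
  have hnn : ∀ i ∈ Finset.univ, 0 ≤ nu i * (1 - nu i) * (lam * q i - lam * p i) ^ 2 /
      ((nu i - lam * q i) * (nu i - lam * p i) ^ 2) := by
    intro i _
    have a := hnu i
    have b := hq.1.2.2 i
    exact div_nonneg (mul_nonneg (mul_nonneg a.1.le (by linarith)) (sq_nonneg _))
      (mul_nonneg (by linarith) (sq_nonneg _))
  have h0 := (Finset.sum_eq_zero_iff_of_nonneg hnn).1
    (le_antisymm (by linarith) (Finset.sum_nonneg hnn))
  funext i
  have h3 := h0 i (Finset.mem_univ i)
  have a := hnu i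
  have b := hq.1.2.2 i
  have b' := hp.2.2 i
  have e1 : 0 < nu i * (1 - nu i) := mul_pos a.1 (by linarith)
  have e2 : 0 < (nu i - lam * q i) * (nu i - lam * p i) ^ 2 :=
    mul_pos (by linarith) (pow_pos (by linarith) 2)
  rw [div_eq_zero_iff, or_iff_left e2.ne', mul_eq_zero, or_iff_right e1.ne',
    sq_eq_zero_iff, sub_eq_zero] at h3
  exact mul_left_cancel₀ hl.ne' h3

theorem wf_exists {K : ℕ} {lam : ℝ} {nu : Fin K → ℝ} (hl : 0 < lam)
    (hnu : ∀ i, 0 < nu i ∧ nu i < 1) (hs : lam < ∑ i, nu i) :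
    ∃ p k, WaterFill K lam nu p k := by
  let F : ℝ → ℝ := fun k => ∑ i, max 0 (nu i - k * wtR (nu i))
  have hF : Continuous F := by fun_prop
  have hF0 : F 0 = ∑ i, nu i := by
    apply Finset.sum_congr rfl
    intro i _
    rw [zero_mul, sub_zero, max_eq_right (hnu i).1.le]
  let B : ℝ := ∑ i, nu i / wtR (nu i)
  have hBt : ∀ i ∈ Finset.univ, 0 ≤ nu i / wtR (nu i) := fun i _ =>
    div_nonneg (hnu i).1.le (wtR_pos (hnu i)).le
  have hB : 0 ≤ B := Finset.sum_nonneg hBt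
  have hFB : F B = 0 := by
    apply Finset.sum_eq_zero
    intro i hi
    apply max_eq_left
    have := Finset.single_le_sum hBt hi
    rw [div_le_iff₀ (wtR_pos (hnu i))] at this
    linarith
  have hmem : lam ∈ Set.Icc (F B) (F 0) := by
    rw [hFB, hF0]; exact ⟨hl.le, hs.le⟩
  obtain ⟨k, hk, hkl⟩ := intermediate_value_Icc' hB hF.continuousOn hmem
  refine ⟨fun i => max 0 (nu i - k * wtR (nu i)) / lam, k, ?_, ?_, ?_⟩
  · rcases hk.1.lt_or_eq with h | h
    · exact h
    · exfalso; rw [← h, hF0] at hkl; linarith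
  · rw [← Finset.sum_div]
    change F k / lam = 1
    rw [hkl, div_self hl.ne']
  · intro i
    field_simp

/-- The level as a function of the support. -/
noncomputable def kapR {K : ℕ} (S : Finset (Fin K)) (lam : ℝ) (nu : Fin K → ℝ) : ℝ :=
  (∑ j ∈ S, nu j - lam) / ∑ j ∈ S, wtR (nu j)

/-- Structure of the optimum with support `S`. -/
theorem opt_structure {K : ℕ} {lam : ℝ} {nu p : Fin K → ℝ} {S : Finset (Fin K)} (hl : 0 < lam)
    (hS : S.Nonempty)
    (hnu : ∀ i, 0 < nu i ∧ nu i < 1) (hs : lam < ∑ i, nu i)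
    (hopt : IsOptimalRouting K lam nu p) (hsup : RoutingSupport K p = S) :
    (∀ i ∈ S, lam * p i = nu i - kapR S lam nu * wtR (nu i)) ∧
    (∀ i ∉ S, p i = 0 ∧ nu i - kapR S lam nu * wtR (nu i) ≤ 0) := by
  obtain ⟨p', k, hwf⟩ := wf_exists hl hnu hs
  have := wf_unique hl hnu hwf hopt
  subst this
  have hmem : ∀ i, i ∈ S ↔ 0 < p i := by
    intro i; rw [← hsup]; simp [RoutingSupport]
  have hp0 : ∀ i ∉ S, p i = 0 := fun i hi =>
    le_antisymm (not_lt.1 fun h => hi ((hmem i).2 h)) (hopt.1.1 i)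
  have h1 : ∀ i ∈ S, lam * p i = nu i - k * wtR (nu i) := by
    intro i hi
    have a := mul_pos hl ((hmem i).1 hi)
    rw [hwf.2.2 i] at a ⊢
    rcases le_total (nu i - k * wtR (nu i)) 0 with h | h
    · rw [max_eq_left h] at a; exact absurd a (lt_irrefl _)
    · exact max_eq_right h
  have hsum : ∑ j ∈ S, p j = 1 := by
    rw [← hwf.2.1]
    exact Finset.sum_subset (Finset.subset_univ _) fun i _ hi => hp0 i hi
  have hW : 0 < ∑ j ∈ S, wtR (nu j) := Finset.sum_pos (fun i _ => wtR_pos (hnu i)) hS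
  have hk : kapR S lam nu = k := by
    unfold kapR
    rw [div_eq_iff hW.ne']
    have := Finset.sum_congr rfl h1
    rw [← Finset.mul_sum, hsum, Finset.sum_sub_distrib, ← Finset.mul_sum] at this
    linarith
  rw [hk]
  refine ⟨h1, fun i hi => ⟨hp0 i hi, ?_⟩⟩
  have := hwf.2.2 i
  rw [hp0 i hi, mul_zero] at this
  rw [this]; exact le_max_right _ _

theorem wt_rel {a b m d : ℝ} (ha : 0 < a ∧ a < 1) (hb : 0 < b ∧ b < 1) (hm : 0 < m)
    (hma : m ≤ a) (hma' : m ≤ 1 - a) (hd : |b - a| ≤ d) :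
    |wtR b - wtR a| ≤ 2 * d / m * wtR a := by
  have hwa := wtR_pos ha
  have hwb := wtR_pos hb
  have ea := wtR_sq ha
  have eb := wtR_sq hb
  have hd0 : 0 ≤ d := (abs_nonneg _).trans hd
  have h1 : |wtR b - wtR a| * (wtR b + wtR a) ≤ d := by
    rw [← abs_of_pos (add_pos hwb hwa), ← abs_mul]
    have : (wtR b - wtR a) * (wtR b + wtR a) = (b - a) * (1 - a - b) := by
      linear_combination eb - ea
    rw [this, abs_mul]
    have : |1 - a - b| ≤ 1 := by rw [abs_le]; constructor <;> linarith
    nlinarith [abs_nonneg (b - a)]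
  have h2 : m / 2 ≤ wtR a ^ 2 := by
    rw [ea]
    rcases le_total a (1 / 2) with h | h <;> nlinarith
  have h3 : |wtR b - wtR a| * wtR a ≤ d := by
    refine le_trans ?_ h1
    exact mul_le_mul_of_nonneg_left (by linarith) (abs_nonneg _)
  have h4 : |wtR b - wtR a| * wtR a ≤ (2 * d / m * wtR a) * wtR a := by
    refine h3.trans ?_
    have : d = 2 * d / m * (m / 2) := by field_simp
    calc d = 2 * d / m * (m / 2) := this
      _ ≤ 2 * d / m * wtR a ^ 2 := mul_le_mul_of_nonneg_left h2 (by positivity)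
      _ = _ := by ring
  exact le_of_mul_le_mul_right h4 hwa

/-- Core perturbation estimate. -/
theorem core_bound {W W' w w' R R' n d e : ℝ} (hw : 0 < w) (hw' : 0 < w') (hwW : w ≤ W)
    (hwW' : w' ≤ W') (hR : 0 ≤ R) (hRR : |R' - R| ≤ n * d)
    (h1 : |w' - w| ≤ e * w) (h2 : |W' - W| ≤ e * W) :
    |R' / W' * w' - R / W * w| ≤ n * d + 2 * e * R := by
  have hW : 0 < W := by linarith
  have hW' : 0 < W' := by linarith
  have id : R' / W' * w' - R / W * w = (R' - R) * (w' / W') +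
      R * ((w' - w) / W - (w' / W') * ((W' - W) / W)) := by
    field_simp; ring
  have he : 0 ≤ e := nonneg_of_mul_nonneg_left ((abs_nonneg _).trans h1) hw
  have q0 : 0 ≤ w' / W' := by positivity
  have q1 : w' / W' ≤ 1 := (div_le_one hW').2 hwW'
  have b1 : |(w' - w) / W| ≤ e := by
    rw [abs_div, abs_of_pos hW, div_le_iff₀ hW]
    exact h1.trans (mul_le_mul_of_nonneg_left hwW he)
  have b2 : |(W' - W) / W| ≤ e := by
    rw [abs_div, abs_of_pos hW, div_le_iff₀ hW]; exact h2
  have b3 : |(w' / W') * ((W' - W) / W)| ≤ e := by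
    rw [abs_mul, abs_of_nonneg q0]
    nlinarith [abs_nonneg ((W' - W) / W)]
  have b4 : |(R' - R) * (w' / W')| ≤ n * d := by
    rw [abs_mul, abs_of_nonneg q0]
    nlinarith [abs_nonneg (R' - R)]
  have b5 : |R * ((w' - w) / W - (w' / W') * ((W' - W) / W))| ≤ R * (e + e) := by
    rw [abs_mul, abs_of_nonneg hR]
    exact mul_le_mul_of_nonneg_left ((abs_sub _ _).trans (add_le_add b1 b3)) hR
  rw [id]
  refine (abs_add_le _ _).trans ?_
  linarith

/-- Estimation error bound: if all service-rate estimates are within `δ ≤ Δ` of the truth,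
then the routing probabilities computed from the estimates are within
`min{cδ, r_i/(4λ)}` of the optimal ones. -/
theorem routing_probability_estimation_error
    (K : ℕ) (lam : ℝ) (mu muhat pstar phat : Fin K → ℝ)
    (hlam0 : 0 < lam) (hlam1 : lam < 1)
    (hmu : ∀ i, 0 < mu i ∧ mu i < 1)
    (hmuhat : ∀ i, 0 < muhat i ∧ muhat i < 1)
    (hstab : lam < ∑ i, mu i)
    (hopt : IsOptimalRouting K lam mu pstar)
    (hoptHat : IsOptimalRouting K lam muhat phat)
    (r : Fin K → ℝ) (hr : ∀ i, r i = mu i - lam * pstar i)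
    (S : Finset (Fin K)) (hSdef : S = RoutingSupport K pstar) (hS : S.Nonempty)
    (mutilde : ℝ) (hmutilde : mutilde = S.inf' hS (fun j => min (mu j) (1 - mu j)))
    (DeltaS : ℝ)
    (hDeltaS : DeltaS = sSup {δ : ℝ | 0 ≤ δ ∧
      ∀ (nu p' : Fin K → ℝ), (∀ i, |nu i - mu i| ≤ δ) →
        IsOptimalRouting K lam nu p' → RoutingSupport K p' = S})
    (hDeltaSpos : 0 < DeltaS)
    (c1 c2 c Delta : ℝ)
    (hc1 : c1 = (1 / lam) * (1 + 4 * (∑ j ∈ S, r j) / mutilde + (S.card : ℝ)))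
    (hc2 : c2 = 1 / lam + 30 * (∑ j ∈ S, r j) / (lam * mutilde) + 16 * (S.card : ℝ) / lam)
    (hc : c = max c1 c2)
    (hDelta : Delta = min (min (mutilde / 2) ((∑ j ∈ S, r j) / (S.card : ℝ)))
      (min ((S.inf' hS r) / (4 * c * lam)) DeltaS))
    (δ : ℝ) (hδ0 : 0 ≤ δ) (hδΔ : δ ≤ Delta)
    (hest : ∀ i, |muhat i - mu i| ≤ δ) :
    ∀ i, |phat i - pstar i| ≤ min (c * δ) (r i / (4 * lam)) := by
  subst hSdef
  set S := RoutingSupport K pstar with hSS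
  have hmt : ∀ j ∈ S, mutilde ≤ mu j ∧ mutilde ≤ 1 - mu j := by
    intro j hj
    have : mutilde ≤ min (mu j) (1 - mu j) := by
      rw [hmutilde]; exact Finset.inf'_le (fun j => min (mu j) (1 - mu j)) hj
    exact le_min_iff.1 this
  have hmt0 : 0 < mutilde := by
    rw [hmutilde, Finset.lt_inf'_iff]
    intro j _
    exact lt_min (hmu j).1 (by linarith [(hmu j).2])
  have hrpos : ∀ i, 0 < r i := fun i => by rw [hr]; linarith [hopt.1.2.2 i]
  have hR0 : 0 < ∑ j ∈ S, r j := Finset.sum_pos (fun i _ => hrpos i) hS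
  have hc1lam : lam * c1 = 1 + 4 * (∑ j ∈ S, r j) / mutilde + (S.card : ℝ) := by
    rw [hc1]; field_simp
  have hc1pos : 1 ≤ lam * c1 := by
    rw [hc1lam]
    have : 0 ≤ 4 * (∑ j ∈ S, r j) / mutilde := by positivity
    have : (0 : ℝ) ≤ S.card := by positivity
    linarith
  have hcc : c1 ≤ c := by rw [hc]; exact le_max_left _ _
  have hclam : 1 ≤ lam * c := hc1pos.trans (mul_le_mul_of_nonneg_left hcc hlam0.le)
  have hcpos : 0 < c := by
    by_contra h
    nlinarith [not_lt.1 h]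
  rw [hDelta, le_min_iff, le_min_iff, le_min_iff] at hδΔ
  obtain ⟨-, hδr, hδD⟩ := hδΔ
  have hδri : ∀ i ∈ S, c * δ ≤ r i / (4 * lam) := by
    intro i hi
    have : δ ≤ r i / (4 * c * lam) := hδr.trans
      (div_le_div_of_nonneg_right (Finset.inf'_le r hi) (by positivity))
    rw [le_div_iff₀ (by positivity)] at this ⊢
    linarith
  have hδr4 : ∀ i ∈ S, 4 * δ ≤ r i := by
    intro i hi
    have := hδri i hi
    rw [le_div_iff₀ (by positivity)] at this
    nlinarith
  have hstabHat : lam < ∑ i, muhat i := by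
    have hne : (Finset.univ : Finset (Fin K)).Nonempty := hS.mono (Finset.subset_univ _)
    have := Finset.sum_lt_sum_of_nonempty hne (fun i _ => hoptHat.1.2.2 i)
    rwa [← Finset.mul_sum, hoptHat.1.2.1, mul_one] at this
  -- the segment
  let nu : ℝ → Fin K → ℝ := fun s i => mu i + s * (muhat i - mu i)
  have hnu1 : nu 1 = muhat := by funext i; simp [nu]
  have hnu : ∀ s ∈ Set.Icc (0:ℝ) 1, ∀ i, 0 < nu s i ∧ nu s i < 1 := by
    intro s hs i
    have h1 := hmu i
    have h2 := hmuhat i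
    have e : nu s i = (1 - s) * mu i + s * muhat i := by simp only [nu]; ring
    rw [e]
    rcases hs.1.lt_or_eq with h | h
    · constructor <;> nlinarith [hs.2, mul_pos h h2.1, mul_pos h (sub_pos.2 h2.2)]
    · rw [← h]; constructor <;> linarith
  have hnus : ∀ s ∈ Set.Icc (0:ℝ) 1, lam < ∑ i, nu s i := by
    intro s hs
    have e : ∑ i, nu s i = (1 - s) * ∑ i, mu i + s * ∑ i, muhat i := by
      rw [Finset.mul_sum, Finset.mul_sum, ← Finset.sum_add_distrib]
      apply Finset.sum_congr rfl; intro i _; simp only [nu]; ring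
    rw [e]
    rcases hs.1.lt_or_eq with h | h
    · nlinarith [hs.2, mul_pos h (sub_pos.2 hstabHat)]
    · rw [← h]; linarith
  let G : Fin K → ℝ → ℝ := fun i s => nu s i - kapR S lam (nu s) * wtR (nu s i)
  have hseg : ∀ s ∈ Set.Ico (0:ℝ) 1, (∀ i ∈ S, 0 ≤ G i s) ∧ (∀ i ∉ S, G i s ≤ 0) := by
    intro s hs
    have hs' : s ∈ Set.Icc (0:ℝ) 1 := ⟨hs.1, hs.2.le⟩
    have hlt : s * δ < DeltaS := by
      rcases hδ0.lt_or_eq with h | h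
      · nlinarith [hs.2]
      · rw [← h, mul_zero]; exact hDeltaSpos
    have hne : {δ : ℝ | 0 ≤ δ ∧ ∀ (nu p' : Fin K → ℝ), (∀ i, |nu i - mu i| ≤ δ) →
        IsOptimalRouting K lam nu p' → RoutingSupport K p' = S}.Nonempty := by
      by_contra h
      rw [Set.not_nonempty_iff_eq_empty] at h
      rw [h, Real.sSup_empty] at hDeltaS
      linarith
    rw [hDeltaS] at hlt
    obtain ⟨d, hd, hsd⟩ := exists_lt_of_lt_csSup hne hlt
    obtain ⟨p, k, hwf⟩ := wf_exists hlam0 (hnu s hs') (hnus s hs')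
    have hop := wf_optimal hlam0 (hnu s hs') hwf
    have hsup := hd.2 (nu s) p (fun i => by
      have : nu s i - mu i = s * (muhat i - mu i) := by simp only [nu]; ring
      rw [this, abs_mul, abs_of_nonneg hs.1]
      exact (mul_le_mul_of_nonneg_left (hest i) hs.1).trans hsd.le) hop
    have hst := opt_structure hlam0 hS (hnu s hs') (hnus s hs') hop hsup
    refine ⟨fun i hi => ?_, fun i hi => (hst.2 i hi).2⟩
    change 0 ≤ nu s i - kapR S lam (nu s) * wtR (nu s i)
    rw [← hst.1 i hi]
    exact mul_nonneg hlam0.le (hop.1.1 i)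
  have hW1 : 0 < ∑ j ∈ S, wtR (muhat j) := Finset.sum_pos (fun i _ => wtR_pos (hmuhat i)) hS
  have hGc : ∀ i, ContinuousAt (G i) 1 := by
    intro i
    have hwc : Continuous wtR := by unfold wtR; fun_prop
    have hnc : ∀ j, Continuous fun s => nu s j := fun j => by simp only [nu]; fun_prop
    refine ((hnc i).continuousAt).sub (ContinuousAt.mul ?_ (hwc.comp (hnc i)).continuousAt)
    unfold kapR
    refine ContinuousAt.div ?_ ?_ ?_
    · exact ((continuous_finsetSum _ fun j _ => hnc j).sub continuous_const).continuousAt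
    · exact (continuous_finsetSum _ fun j _ => hwc.comp (hnc j)).continuousAt
    · rw [hnu1]; exact hW1.ne'
  have hev : ∀ᶠ s in nhdsWithin (1:ℝ) (Set.Iio 1), s ∈ Set.Ico (0:ℝ) 1 :=
    Ico_mem_nhdsLT (by norm_num)
  have hGS : ∀ i ∈ S, 0 ≤ G i 1 := fun i hi =>
    ge_of_tendsto ((hGc i).tendsto.mono_left nhdsWithin_le_nhds)
      (hev.mono fun s hs => (hseg s hs).1 i hi)
  have hGN : ∀ i ∉ S, G i 1 ≤ 0 := fun i hi =>
    le_of_tendsto ((hGc i).tendsto.mono_left nhdsWithin_le_nhds)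
      (hev.mono fun s hs => (hseg s hs).2 i hi)
  simp only [G, hnu1] at hGS hGN
  -- structure at mu
  have hst := opt_structure hlam0 hS hmu hstab hopt rfl
  have hpsum : ∑ j ∈ S, pstar j = 1 := by
    rw [← hopt.1.2.1]
    exact Finset.sum_subset (Finset.subset_univ _) fun i _ hi => (hst.2 i hi).1
  have hRe : ∑ j ∈ S, r j = ∑ j ∈ S, mu j - lam := by
    rw [Finset.sum_congr rfl fun j _ => hr j, Finset.sum_sub_distrib, ← Finset.mul_sum, hpsum,
      mul_one]
  have hRd : |(∑ j ∈ S, muhat j - lam) - (∑ j ∈ S, mu j - lam)| ≤ (S.card : ℝ) * δ := by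
    have : (∑ j ∈ S, muhat j - lam) - (∑ j ∈ S, mu j - lam) = ∑ j ∈ S, (muhat j - mu j) := by
      rw [Finset.sum_sub_distrib]; ring
    rw [this]
    refine (Finset.abs_sum_le_sum_abs _ _).trans ?_
    refine (Finset.sum_le_sum fun j _ => hest j).trans ?_
    rw [Finset.sum_const, nsmul_eq_mul]
  have hRhat : 0 < ∑ j ∈ S, muhat j - lam := by
    have h4 : ∑ j ∈ S, 4 * δ ≤ ∑ j ∈ S, r j := Finset.sum_le_sum hδr4
    rw [Finset.sum_const, nsmul_eq_mul] at h4
    have := (abs_le.1 hRd).1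
    linarith
  have hkhat : 0 < kapR S lam muhat := div_pos hRhat hW1
  -- water-filling at muhat
  let q : Fin K → ℝ := fun i => max 0 (muhat i - kapR S lam muhat * wtR (muhat i)) / lam
  have hqS : ∀ i ∈ S, lam * q i = muhat i - kapR S lam muhat * wtR (muhat i) := by
    intro i hi
    simp only [q]
    rw [max_eq_right (hGS i hi)]
    field_simp
  have hqN : ∀ i ∉ S, q i = 0 := by
    intro i hi
    simp only [q]
    rw [max_eq_left (hGN i hi), zero_div]
  have hqwf : WaterFill K lam muhat q (kapR S lam muhat) := by
    refine ⟨hkhat, ?_, fun i => ?_⟩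
    · rw [← Finset.sum_subset (Finset.subset_univ S) fun i _ hi => hqN i hi]
      have := Finset.sum_congr rfl hqS
      rw [← Finset.mul_sum, Finset.sum_sub_distrib, ← Finset.mul_sum] at this
      have e : kapR S lam muhat * ∑ j ∈ S, wtR (muhat j) = ∑ j ∈ S, muhat j - lam :=
        div_mul_cancel₀ _ hW1.ne'
      rw [e] at this
      have h5 : lam * ∑ j ∈ S, q j = lam * 1 := by linarith
      exact mul_left_cancel₀ hlam0.ne' h5
    · simp only [q]; field_simp
  have hpq := wf_unique hlam0 hmuhat hqwf hoptHat
  intro i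
  by_cases hi : i ∈ S
  · suffices h : |phat i - pstar i| ≤ c * δ from le_min h (h.trans (hδri i hi))
    have hrel : ∀ j ∈ S, |wtR (muhat j) - wtR (mu j)| ≤ 2 * δ / mutilde * wtR (mu j) :=
      fun j hj => wt_rel (hmu j) (hmuhat j) hmt0 (hmt j hj).1 (hmt j hj).2 (hest j)
    have hrelW : |∑ j ∈ S, wtR (muhat j) - ∑ j ∈ S, wtR (mu j)| ≤
        2 * δ / mutilde * ∑ j ∈ S, wtR (mu j) := by
      rw [← Finset.sum_sub_distrib, Finset.mul_sum]
      exact (Finset.abs_sum_le_sum_abs _ _).trans (Finset.sum_le_sum hrel)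
    have hb := core_bound (wtR_pos (hmu i)) (wtR_pos (hmuhat i))
      (Finset.single_le_sum (f := fun j => wtR (mu j)) (fun j _ => (wtR_pos (hmu j)).le) hi)
      (Finset.single_le_sum (f := fun j => wtR (muhat j))
        (fun j _ => (wtR_pos (hmuhat j)).le) hi)
      (hRe ▸ hR0.le) hRd (hrel i hi) hrelW
    have e1 := hqS i hi
    rw [← hpq] at e1
    have e2 := hst.1 i hi
    unfold kapR at e1 e2
    have hl : |lam * (phat i - pstar i)| ≤ lam * (c1 * δ) := by
      rw [← mul_assoc, hc1lam, hRe]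
      have e3 : 4 * (∑ j ∈ S, mu j - lam) / mutilde * δ
          = 2 * (2 * δ / mutilde) * (∑ j ∈ S, mu j - lam) := by ring
      have h6 := abs_le.1 hb
      have h7 := abs_le.1 (hest i)
      rw [add_mul, add_mul, one_mul, e3, mul_sub, e1, e2, abs_le]
      constructor <;> linarith
    rw [abs_mul, abs_of_pos hlam0] at hl
    exact (le_of_mul_le_mul_left hl hlam0).trans (mul_le_mul_of_nonneg_right hcc hδ0)
  · rw [hpq, hqN i hi, (hst.2 i hi).1, sub_zero, abs_zero]
    have := hrpos i
    exact le_min (by positivity) (by positivity)
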